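/- For the cyclic polytope boundary complex CP(m,2n+1): if n = 1 and m > 3 then χ_1(CP(m,3)) = 4, and if n > 1 and m > 2n+1 then χ_n(CP(m,2n+1)) = 3. -/

import Mathlib

open MvPolynomial

/-- `K` is a (finite) abstract simplicial complex on the vertex set `V`:
a collection of subsets of `V` closed under taking subsets. -/
def IsASC {V : Type*} (K : Set (Finset V)) : Prop :=
  ∀ σ ∈ K, ∀ τ ⊆ σ, τ ∈ K

/-- `f : V → P` is a `(P,s)`-coloring of `K`: every simplex contains at most `s`
vertices of any given color. -/
def IsColoring {V P : Type*} [DecidableEq P] (K : Set (Finset V)) (s : ℕ) (f : V → P) : Prop :=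
  ∀ σ ∈ K, ∀ p : P, (σ.filter fun v => f v = p).card ≤ s

/-- The `s`-chromatic number of `K`: the least `r` such that `K` admits a coloring
from a palette of `r` colors. -/
noncomputable def chrom {V : Type*} (K : Set (Finset V)) (s : ℕ) : ℕ :=
  sInf {r : ℕ | ∃ f : V → Fin r, IsColoring K s f}

/-- Gale's evenness condition: `σ` is a facet of the boundary complex of the cyclic
`n`-polytope on the ordered vertex set `Fin m` iff `|σ| = n` and between any two
vertices not in `σ` there is an even number of vertices of `σ`. -/
def GaleFacet (m n : ℕ) (σ : Finset (Fin m)) : Prop :=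
  σ.card = n ∧ ∀ i j : Fin m, i ∉ σ → j ∉ σ → i < j →
    Even (σ.filter fun k => i < k ∧ k < j).card

/-- The boundary complex `CP(m,n)` of the cyclic `n`-polytope on `m` vertices:
its simplices are the subsets of the facets given by Gale's evenness condition. -/
def CP (m n : ℕ) : Set (Finset (Fin m)) :=
  {τ | ∃ σ : Finset (Fin m), GaleFacet m n σ ∧ τ ⊆ σ}

/-- If a set of naturals contains everything below a gap `p`, and the number of its elements
between `p` and any later gap is even, then its even and odd elements are balanced, up to the
possible initial and final elements of odd blocks. -/
lemma count_parity_of_gap {s : ℕ → Prop} [DecidablePred s] {m p : ℕ}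
    (hlt : ∀ k < p, s k)
    (hgap : ∀ j, p < j → j < m → ¬ s j → Even (Nat.count s j + p)) :
    ∀ j, p ≤ j → j ≤ m →
      Nat.count s j = Nat.count (fun k => s k ∧ k % 2 = 0) j +
        Nat.count (fun k => s k ∧ k % 2 = 1) j ∧
      (((Nat.count s j + p) % 2 = 0 ∧
        Nat.count (fun k => s k ∧ k % 2 = 0) j =
          Nat.count (fun k => s k ∧ k % 2 = 1) j + p % 2) ∨
      ((Nat.count s j + p) % 2 = 1 ∧ p < j ∧ s (j - 1) ∧
        Nat.count (fun k => s k ∧ k % 2 = 0) j + (1 - j % 2) =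
          Nat.count (fun k => s k ∧ k % 2 = 1) j + p % 2 + j % 2)) := by
  have hinit : ∀ j ≤ p, Nat.count s j = j ∧
      Nat.count s j = Nat.count (fun k => s k ∧ k % 2 = 0) j +
        Nat.count (fun k => s k ∧ k % 2 = 1) j ∧
      Nat.count (fun k => s k ∧ k % 2 = 0) j =
          Nat.count (fun k => s k ∧ k % 2 = 1) j + j % 2 := by
    intro j
    induction j with
    | zero => simp
    | succ j ih =>
      intro hj
      obtain ⟨h1, h2, h3⟩ := ih (by omega)
      have hs := hlt j (by omega)
      simp only [Nat.count_succ, hs, true_and, if_true]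
      rcases Nat.mod_two_eq_zero_or_one j with h | h <;> simp [h] <;> omega
  intro j hj
  induction j, hj using Nat.le_induction with
  | base =>
    intro _
    obtain ⟨h1, h2, h3⟩ := hinit p le_rfl
    exact ⟨h2, Or.inl ⟨by omega, h3⟩⟩
  | succ j hj ih =>
    intro hjm
    obtain ⟨h2, h3⟩ := ih (by omega)
    by_cases hs : s j
    · simp only [Nat.count_succ, hs, true_and, if_true, Nat.add_sub_cancel]
      rcases Nat.mod_two_eq_zero_or_one j with h | h <;> simp [h] <;> omega
    · have he : (Nat.count s j + p) % 2 = 0 := by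
        rcases hj.eq_or_lt with rfl | hlt'
        · have := (hinit p le_rfl).1
          omega
        · exact Nat.even_iff.1 (hgap j hlt' (by omega) hs)
      simp only [Nat.count_succ, hs, false_and, if_false, Nat.add_sub_cancel]
      omega

lemma card_filter_between {m : ℕ} (σ : Finset (Fin m)) (i j : Fin m) (hi : i ∉ σ) (hij : i < j) :
    Nat.count (· ∈ σ.map Fin.valEmbedding) j =
      Nat.count (· ∈ σ.map Fin.valEmbedding) i + (σ.filter fun k => i < k ∧ k < j).card := by
  rw [Nat.count_eq_card_filter_range, Nat.count_eq_card_filter_range,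
    ← Finset.card_map Fin.valEmbedding, ← Finset.card_union_of_disjoint]
  · congr 1
    ext x
    simp only [Finset.mem_filter, Finset.mem_range, Finset.mem_map, Finset.mem_union,
      Fin.valEmbedding_apply]
    constructor
    · rintro ⟨hx, y, hy, rfl⟩
      rcases lt_trichotomy y i with h | rfl | h
      · exact Or.inl ⟨h, y, hy, rfl⟩
      · exact absurd hy hi
      · exact Or.inr ⟨y, ⟨hy, h, hx⟩, rfl⟩
    · rintro (⟨hx, y, hy, rfl⟩ | ⟨y, ⟨hy, h, h'⟩, rfl⟩)
      · exact ⟨lt_trans hx hij, y, hy, rfl⟩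
      · exact ⟨h', y, hy, rfl⟩
  · rw [Finset.disjoint_left]
    simp only [Finset.mem_filter, Finset.mem_range, Finset.mem_map, Fin.valEmbedding_apply]
    rintro x ⟨hx, -⟩ ⟨y, ⟨-, h, -⟩, rfl⟩
    exact absurd hx (not_lt.2 (Fin.le_def.1 h.le))

lemma count_mem_map_val {m : ℕ} (σ : Finset (Fin m)) (q : ℕ → Prop) [DecidablePred q] :
    Nat.count (fun k => k ∈ σ.map Fin.valEmbedding ∧ q k) m =
      (σ.filter fun k : Fin m => q k.val).card := by
  rw [Nat.count_eq_card_filter_range, ← Finset.card_map Fin.valEmbedding]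
  congr 1
  ext x
  simp only [Finset.mem_filter, Finset.mem_range, Finset.mem_map, Fin.valEmbedding_apply]
  constructor
  · rintro ⟨_, ⟨y, hy, rfl⟩, hq⟩
    exact ⟨y, ⟨hy, hq⟩, rfl⟩
  · rintro ⟨y, ⟨hy, hq⟩, rfl⟩
    exact ⟨y.2, ⟨y, hy, rfl⟩, hq⟩

/-- A facet of `CP(m,2n+1)` has at most `n` interior vertices of each parity. -/
lemma GaleFacet.card_interior_parity_le {m n : ℕ} {σ : Finset (Fin m)}
    (hσ : GaleFacet m (2 * n + 1) σ) (hm : 2 * n + 1 < m) (c : ℕ) (hc : c < 2) :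
    (σ.filter fun k => (k.val ≠ 0 ∧ k.val ≠ m - 1) ∧ k.val % 2 = c).card ≤ n := by
  classical
  obtain ⟨hcard, hgale⟩ := hσ
  set s : ℕ → Prop := (· ∈ σ.map Fin.valEmbedding) with hs
  have hmem (k : Fin m) : s k ↔ k ∈ σ := by simp [hs, Fin.val_inj]
  have hex : ∃ k, ¬ s k := ⟨m, by simp [hs]; intro x _; exact x.2.ne⟩
  have hpm : Nat.find hex < m := by
    by_contra h
    have : σ = Finset.univ := by
      ext k
      have := Nat.find_min hex (lt_of_lt_of_le k.2 (not_lt.1 h))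
      simpa [← hmem] using this
    rw [this, Finset.card_univ, Fintype.card_fin] at hcard
    omega
  generalize hpe : Nat.find hex = p at hpm
  have hp : ¬ s p := hpe ▸ Nat.find_spec hex
  have hlt : ∀ k < p, s k := fun k hk => not_not.1 (Nat.find_min hex (hpe ▸ hk))
  have hcp : Nat.count s p = p := Nat.count_iff_forall.2 (fun {k} hk => hlt k hk)
  obtain ⟨h1, h2⟩ := count_parity_of_gap (m := m) hlt (fun j hpj hjm hj => by
    have := card_filter_between σ ⟨p, hpm⟩ ⟨j, hjm⟩ (fun h => hp ((hmem ⟨p, hpm⟩).2 h)) hpj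
    have hev := hgale ⟨p, hpm⟩ ⟨j, hjm⟩ (fun h => hp ((hmem ⟨p, hpm⟩).2 h))
      (fun h => hj ((hmem ⟨j, hjm⟩).2 h)) hpj
    change Nat.count s j = Nat.count s p + _ at this
    rw [this, hcp]
    rw [Nat.even_iff] at hev ⊢
    omega) m hpm.le le_rfl
  have hcm : Nat.count s m = 2 * n + 1 := by
    have := count_mem_map_val σ (fun _ => True)
    simp only [and_true, Finset.filter_true, hcard] at this
    exact this
  have hce := count_mem_map_val σ (fun k => k % 2 = 0)
  have hco := count_mem_map_val σ (fun k => k % 2 = 1)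
  change Nat.count (fun k => s k ∧ _) m = _ at hce hco
  rw [hcm, hce, hco] at h1
  rw [hcm, hce, hco] at h2
  have hle : (σ.filter fun k => (k.val ≠ 0 ∧ k.val ≠ m - 1) ∧ k.val % 2 = c).card ≤
      (σ.filter fun k => k.val % 2 = c).card :=
    Finset.card_le_card (Finset.monotone_filter_right _ fun _ _ h => h.2)
  have hlt' : ∀ x ∈ σ, (x.val = 0 ∨ x.val = m - 1) → x.val % 2 = c →
      (σ.filter fun k => (k.val ≠ 0 ∧ k.val ≠ m - 1) ∧ k.val % 2 = c).card <
      (σ.filter fun k => k.val % 2 = c).card := by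
    intro x hx hx' hxc
    apply Finset.card_lt_card
    refine Finset.ssubset_iff_of_subset
      (Finset.monotone_filter_right _ fun _ _ h => h.2) |>.2 ⟨x, ?_, ?_⟩
    · simp [hx, hxc]
    · simp only [Finset.mem_filter, not_and]
      omega
  rcases h2 with ⟨h2, h3⟩ | ⟨h2, -, h4, h3⟩
  · have h0 := hlt' ⟨0, by omega⟩ ((hmem ⟨0, by omega⟩).1 (hlt 0 (by omega))) (Or.inl rfl)
    obtain rfl | rfl : c = 0 ∨ c = 1 := by omega
    · have := h0 rfl
      omega
    · omega
  · have h0 := hlt' ⟨m - 1, by omega⟩ ((hmem ⟨m - 1, by omega⟩).1 h4) (Or.inr rfl)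
    simp only at h0
    obtain rfl | rfl : c = 0 ∨ c = 1 := by omega
    · rcases Nat.mod_two_eq_zero_or_one m with h | h
      · omega
      · have := h0 (by omega)
        omega
    · rcases Nat.mod_two_eq_zero_or_one m with h | h
      · have := h0 (by omega)
        omega
      · omega

/-- The initial segment of `n` vertices is a facet of `CP(m,n)`. -/
lemma galeFacet_initial {m n : ℕ} (hm : n < m) :
    GaleFacet m n (Finset.univ.filter fun k : Fin m => k.val < n) := by
  refine ⟨?_, ?_⟩
  · have : (Finset.univ.filter fun k : Fin m => k.val < n) = Finset.Iio ⟨n, hm⟩ := by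
      ext k
      simp [Fin.lt_def]
    rw [this, Fin.card_Iio]
  · intro i j hi hj hij
    rw [Finset.filter_filter, Finset.filter_false_of_mem]
    · simp
    · simp only [Finset.mem_filter, Finset.mem_univ, true_and, not_lt, Fin.lt_def] at *
      omega

lemma galeFacet_triple {m : ℕ} {a b c : Fin m}
    (hab : (a.val = 0 ∧ b.val = 1) ∨ (a.val = 1 ∧ b.val = 2)) (hbc : b < c)
    (hc : c.val = 2 ∨ c.val = m - 1) : GaleFacet m 3 {a, b, c} := by
  rw [Fin.lt_def] at hbc
  refine ⟨Finset.card_eq_three.2 ⟨a, b, c, by grind, by grind, by grind, rfl⟩, ?_⟩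
  intro i j hi hj hij
  simp only [Finset.mem_insert, Finset.mem_singleton, not_or, Fin.ext_iff] at hi hj
  rw [Fin.lt_def] at hij
  by_cases hia : i < a
  · have : ({a, b, c} : Finset (Fin m)).filter (fun k => i < k ∧ k < j) = {a, b} := by
      ext k
      simp only [Finset.mem_filter, Finset.mem_insert, Finset.mem_singleton, Fin.ext_iff,
        Fin.lt_def] at *
      omega
    rw [this, Finset.card_pair (by grind)]
    exact even_two
  · rw [Finset.filter_false_of_mem]
    · simp
    · intro k
      simp only [Finset.mem_insert, Finset.mem_singleton, Fin.ext_iff, Fin.lt_def] at *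
      omega

lemma chrom_eq_of_coloring {V : Type*} {K : Set (Finset V)} {s r : ℕ}
    (h : ∃ f : V → Fin r, IsColoring K s f)
    (hlow : ∀ r' (f : V → Fin r'), IsColoring K s f → r ≤ r') : chrom K s = r :=
  le_antisymm (Nat.sInf_le h) (le_csInf ⟨r, h⟩ fun r' ⟨f, hf⟩ => hlow r' f hf)

lemma IsColoring.card_le {V P : Type*} [DecidableEq P] [Fintype P] {K : Set (Finset V)} {s : ℕ}
    {f : V → P} (hf : IsColoring K s f) {σ : Finset V} (hσ : σ ∈ K) :
    σ.card ≤ s * Fintype.card P := by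
  have := Finset.card_le_mul_card_image_of_maps_to (f := f) (s := σ) (t := Finset.univ)
    (fun _ _ => Finset.mem_univ _) s (fun p _ => hf σ hσ p)
  simpa using this

lemma isColoring_CP_of_facet {m n s : ℕ} {P : Type*} [DecidableEq P] {f : Fin m → P}
    (h : ∀ σ, GaleFacet m n σ → ∀ p, (σ.filter fun v => f v = p).card ≤ s) :
    IsColoring (CP m n) s f := by
  rintro τ ⟨σ, hσ, hτ⟩ p
  exact (Finset.card_le_card (Finset.filter_subset_filter _ hτ)).trans (h σ hσ p)

/-- For the cyclic polytope boundary complex `CP(m,2n+1)`: if `n = 1`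
and `m > 3` then `χ₁(CP(m,3)) = 4`, and if `n > 1` and `m > 2n+1` then
`χ_n(CP(m,2n+1)) = 3`. -/
theorem chrom_cyclic_odd :
    (∀ m : ℕ, 3 < m → chrom (CP m 3) 1 = 4) ∧
    (∀ n m : ℕ, 1 < n → 2 * n + 1 < m → chrom (CP m (2 * n + 1)) n = 3) := by
  refine ⟨fun m hm => ?_, fun n m hn hm => ?_⟩
  · apply chrom_eq_of_coloring
    · refine ⟨fun k => if k.val = 0 then 2 else if k.val = m - 1 then 3 else
        if k.val % 2 = 0 then 0 else 1, isColoring_CP_of_facet fun σ hσ p => ?_⟩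
      have key := GaleFacet.card_interior_parity_le (n := 1) hσ hm
      fin_cases p
      · refine le_trans (Finset.card_le_card ?_) (key 0 (by omega))
        refine Finset.monotone_filter_right _ fun k _ h => ?_
        grind
      · refine le_trans (Finset.card_le_card ?_) (key 1 (by omega))
        refine Finset.monotone_filter_right _ fun k _ h => ?_
        grind
      all_goals
        rw [Finset.card_le_one]
        intro a ha b hb
        simp only [Finset.mem_filter] at ha hb
        grind
    · intro r f hf
      have hadj : ∀ a b c : Fin m, a ≠ b → a ≠ c → b ≠ c →
          GaleFacet m 3 {a, b, c} → f a ≠ f b ∧ f a ≠ f c ∧ f b ≠ f c := by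
        intro a b c hab hac hbc hg
        have := fun p => Finset.card_le_one.1 (hf _ ⟨_, hg, subset_rfl⟩ p)
        refine ⟨fun h => hab ?_, fun h => hac ?_, fun h => hbc ?_⟩
        · exact this (f a) a (by simp) b (by simp [h])
        · exact this (f a) a (by simp) c (by simp [h])
        · exact this (f b) b (by simp) c (by simp [h])
      have h012 := hadj ⟨0, by omega⟩ ⟨1, by omega⟩ ⟨2, by omega⟩ (by simp) (by simp) (by simp)
        (galeFacet_triple (Or.inl ⟨rfl, rfl⟩) (by simp) (Or.inl rfl))
      have h01m := hadj ⟨0, by omega⟩ ⟨1, by omega⟩ ⟨m - 1, by omega⟩ (by simp)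
        (by simp; omega) (by simp; omega)
        (galeFacet_triple (Or.inl ⟨rfl, rfl⟩) (by simp; omega) (Or.inr rfl))
      have h12m := hadj ⟨1, by omega⟩ ⟨2, by omega⟩ ⟨m - 1, by omega⟩ (by simp)
        (by simp; omega) (by simp; omega)
        (galeFacet_triple (Or.inr ⟨rfl, rfl⟩) (by simp; omega) (Or.inr rfl))
      have hcard : ({f ⟨0, by omega⟩, f ⟨1, by omega⟩, f ⟨2, by omega⟩,
          f ⟨m - 1, by omega⟩} : Finset (Fin r)).card = 4 := by
        rw [Finset.card_insert_of_notMem, Finset.card_insert_of_notMem, Finset.card_pair]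
        · exact h12m.2.2
        · simp only [Finset.mem_insert, Finset.mem_singleton, not_or]
          exact ⟨h012.2.2, h01m.2.2⟩
        · simp only [Finset.mem_insert, Finset.mem_singleton, not_or]
          exact ⟨h012.1, h012.2.1, h01m.2.1⟩
      simpa [hcard] using Finset.card_le_univ ({f ⟨0, by omega⟩, f ⟨1, by omega⟩,
        f ⟨2, by omega⟩, f ⟨m - 1, by omega⟩} : Finset (Fin r))
  · apply chrom_eq_of_coloring
    · refine ⟨fun k => if k.val = 0 ∨ k.val = m - 1 then 2 else
        if k.val % 2 = 0 then 0 else 1, isColoring_CP_of_facet fun σ hσ p => ?_⟩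
      have key := hσ.card_interior_parity_le hm
      fin_cases p
      · refine le_trans (Finset.card_le_card ?_) (key 0 (by omega))
        refine Finset.monotone_filter_right _ fun k _ h => ?_
        grind
      · refine le_trans (Finset.card_le_card ?_) (key 1 (by omega))
        refine Finset.monotone_filter_right _ fun k _ h => ?_
        grind
      · refine le_trans (Finset.card_le_card (t := {⟨0, by omega⟩, ⟨m - 1, by omega⟩}) ?_)
          (Finset.card_le_two.trans hn)
        intro k hk
        simp only [Finset.mem_filter] at hk
        simp only [Finset.mem_insert, Finset.mem_singleton, Fin.ext_iff]
        grind
    · intro r f hf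
      have hg := galeFacet_initial hm
      have := hf.card_le ⟨_, hg, subset_rfl⟩
      rw [hg.1, Fintype.card_fin] at this
      by_contra! h
      have : n * r ≤ n * 2 := Nat.mul_le_mul_left n (by omega)
      omega
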